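/- Let (Ω, ℱ, P) be a probability space, K and L positive integers, ỹ : Ω → EuclideanSpace ℝ (Fin L) measurable with every component ỹ_l(ω) ∈ [0,1], a : Ω → Fin K measurable with P(a = k) > 0 for every k ∈ Fin K, and y : Ω → Finset (Fin L) measurable. Let y_adv be a nonempty Finset of Fin L. For γ > 0 set s_γ(ω) = exp(γ·(Jac(y(ω), y_adv) − 1)), and define the s_γ-SimFair violation ℓ(γ) = Σ_{k ∈ Fin K} ‖ (∫ s_γ(ω) • ỹ(ω) dP)/(∫ s_γ dP) − (∫ 1{a = k}·s_γ(ω) • ỹ(ω) dP)/(∫ 1{a = k}·s_γ dP) ‖. Then, as γ → 0 within the positive reals, ℓ(γ) converges to the Demographic Parity violation Σ_{k ∈ Fin K} ‖ ∫ ỹ dP − (∫ 1{a = k} • ỹ dP)/P(a = k) ‖. -/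

import Mathlib

open MeasureTheory

/-- The Jaccard score between two finsets with nonempty union. -/
noncomputable def jaccard {α : Type*} [DecidableEq α] (A B : Finset α) : ℝ :=
  ((A ∩ B).card : ℝ) / ((A ∪ B).card : ℝ)

/-- The similarity `s_γ(A, B) = exp(γ·(Jac(A, B) − 1))`. -/
noncomputable def simil {α : Type*} [DecidableEq α] (γ : ℝ) (A B : Finset α) : ℝ :=
  Real.exp (γ * (jaccard A B - 1))

/-- The `s`-weighted fairness violation
`Σ_k ‖ (∫ s • ytil dP)/(∫ s dP) − (∫ 1{a = k}·s • ytil dP)/(∫ 1{a = k}·s dP) ‖`. -/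
noncomputable def fairViolation {Ω : Type*} [MeasurableSpace Ω] (P : Measure Ω)
    {K L : ℕ} (ytil : Ω → EuclideanSpace ℝ (Fin L)) (a : Ω → Fin K) (s : Ω → ℝ) : ℝ :=
  ∑ k : Fin K,
    ‖(∫ ω, s ω ∂P)⁻¹ • (∫ ω, s ω • ytil ω ∂P)
      - (∫ ω in {ω | a ω = k}, s ω ∂P)⁻¹ • (∫ ω in {ω | a ω = k}, s ω • ytil ω ∂P)‖

lemma jaccard_le_one {α : Type*} [DecidableEq α] (A B : Finset α) : jaccard A B ≤ 1 :=
  div_le_one_of_le₀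
    (by exact_mod_cast Finset.card_le_card (Finset.inter_subset_left.trans Finset.subset_union_left))
    (Nat.cast_nonneg _)

lemma simil_le_one {α : Type*} [DecidableEq α] {γ : ℝ} (hγ : 0 ≤ γ) (A B : Finset α) :
    simil γ A B ≤ 1 :=
  Real.exp_le_one_iff.2 (mul_nonpos_of_nonneg_of_nonpos hγ (sub_nonpos.2 (jaccard_le_one A B)))

lemma simil_pos {α : Type*} [DecidableEq α] (γ : ℝ) (A B : Finset α) : 0 < simil γ A B :=
  Real.exp_pos _

lemma tendsto_simil_nhds_zero {α : Type*} [DecidableEq α] (A B : Finset α) :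
    Filter.Tendsto (fun γ : ℝ => simil γ A B) (nhds 0) (nhds 1) := by
  have h : Continuous fun γ : ℝ => simil γ A B := by
    unfold simil
    fun_prop
  simpa [simil] using h.tendsto 0

/-- A function of a finset-valued random variable with measurable fibres is measurable. -/
lemma measurable_comp_of_measurableSet_fiber {Ω β γ : Type*} [MeasurableSpace Ω]
    [MeasurableSpace γ] [Countable β] {y : Ω → β} (hy : ∀ b, MeasurableSet {ω | y ω = b})
    (g : β → γ) : Measurable fun ω => g (y ω) := by
  let _ : MeasurableSpace β := ⊤
  exact measurable_from_top.comp (measurable_to_countable' hy)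

lemma tendsto_integral_simil_smul {Ω α E : Type*} [MeasurableSpace Ω] [Fintype α]
    [DecidableEq α] [NormedAddCommGroup E] [NormedSpace ℝ E] {μ : Measure Ω}
    {y : Ω → Finset α} (hy : ∀ S, MeasurableSet {ω | y ω = S}) (B : Finset α)
    {f : Ω → E} (hf : Integrable f μ) :
    Filter.Tendsto (fun γ : ℝ => ∫ ω, simil γ (y ω) B • f ω ∂μ)
      (nhdsWithin 0 (Set.Ioi 0)) (nhds (∫ ω, f ω ∂μ)) := by
  refine tendsto_integral_filter_of_dominated_convergence (fun ω => ‖f ω‖) ?_ ?_ hf.norm ?_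
  · refine Filter.Eventually.of_forall fun γ => ?_
    exact (measurable_comp_of_measurableSet_fiber hy
      fun S => simil γ S B).aestronglyMeasurable.smul hf.aestronglyMeasurable
  · filter_upwards [self_mem_nhdsWithin] with γ hγ
    refine Filter.Eventually.of_forall fun ω => ?_
    rw [norm_smul, Real.norm_of_nonneg (simil_pos _ _ _).le]
    exact mul_le_of_le_one_left (norm_nonneg _) (simil_le_one (le_of_lt hγ) _ _)
  · refine Filter.Eventually.of_forall fun ω => ?_
    simpa using ((tendsto_simil_nhds_zero (y ω) B).mono_left nhdsWithin_le_nhds).smul_const (f ω)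

/-- The `s_γ`-weighted average of an integrable function converges to its plain average. -/
lemma tendsto_weighted_average_simil {Ω α E : Type*} [MeasurableSpace Ω] [Fintype α]
    [DecidableEq α] [NormedAddCommGroup E] [NormedSpace ℝ E] {μ : Measure Ω}
    [IsFiniteMeasure μ] [NeZero μ]
    {y : Ω → Finset α} (hy : ∀ S, MeasurableSet {ω | y ω = S}) (B : Finset α)
    {f : Ω → E} (hf : Integrable f μ) :
    Filter.Tendsto
      (fun γ : ℝ => (∫ ω, simil γ (y ω) B ∂μ)⁻¹ • ∫ ω, simil γ (y ω) B • f ω ∂μ)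
      (nhdsWithin 0 (Set.Ioi 0)) (nhds ((μ.real Set.univ)⁻¹ • ∫ ω, f ω ∂μ)) := by
  have h := tendsto_integral_simil_smul hy B (integrable_const (μ := μ) (1 : ℝ))
  simp only [smul_eq_mul, mul_one, integral_const] at h
  exact (h.inv₀ measureReal_univ_ne_zero).smul
    (tendsto_integral_simil_smul hy B hf)

lemma integrable_of_forall_apply_mem_Icc {Ω ι : Type*} [MeasurableSpace Ω] [Fintype ι]
    {μ : Measure Ω} [IsFiniteMeasure μ] {f : Ω → EuclideanSpace ℝ ι} (hf : Measurable f)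
    (hbd : ∀ ω i, f ω i ∈ Set.Icc (0 : ℝ) 1) : Integrable f μ := by
  refine Integrable.of_bound hf.aestronglyMeasurable √(Fintype.card ι)
    (Filter.Eventually.of_forall fun ω => ?_)
  rw [EuclideanSpace.norm_eq]
  refine Real.sqrt_le_sqrt ?_
  have h : ∀ i ∈ Finset.univ, ‖f ω i‖ ^ 2 ≤ (1 : ℝ) := fun i _ => by
    rw [Real.norm_of_nonneg (hbd ω i).1]
    exact pow_le_one₀ (hbd ω i).1 (hbd ω i).2
  simpa using Finset.sum_le_sum h

/-- DP direction of Proposition 3: the `s_γ`-SimFair violation converges, as `γ → 0`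
within the positive reals, to the Demographic Parity violation. -/
theorem stmt9 {Ω : Type*} [MeasurableSpace Ω]
    (P : Measure Ω) [IsProbabilityMeasure P]
    (K L : ℕ) (hK : 0 < K) (hL : 0 < L)
    (ytil : Ω → EuclideanSpace ℝ (Fin L)) (hmeas : Measurable ytil)
    (hbd : ∀ ω l, ytil ω l ∈ Set.Icc (0 : ℝ) 1)
    (a : Ω → Fin K) (ha : Measurable a)
    (hapos : ∀ k : Fin K, 0 < P {ω | a ω = k})
    (y : Ω → Finset (Fin L)) (hy : ∀ S : Finset (Fin L), MeasurableSet {ω | y ω = S})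
    (yadv : Finset (Fin L)) (hyadv : yadv.Nonempty) :
    Filter.Tendsto
      (fun γ : ℝ => fairViolation P ytil a (fun ω => simil γ (y ω) yadv))
      (nhdsWithin 0 (Set.Ioi 0))
      (nhds (∑ k : Fin K,
        ‖(∫ ω, ytil ω ∂P)
          - (P {ω | a ω = k}).toReal⁻¹ • (∫ ω in {ω | a ω = k}, ytil ω ∂P)‖)) := by
  have hint : Integrable ytil P := integrable_of_forall_apply_mem_Icc hmeas hbd
  unfold fairViolation
  refine tendsto_finsetSum _ fun k _ => (Filter.Tendsto.sub ?_ ?_).norm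
  · simpa using tendsto_weighted_average_simil hy yadv hint
  · have : NeZero (P.restrict {ω | a ω = k}) :=
      ⟨fun h => (hapos k).ne' (Measure.restrict_eq_zero.1 h)⟩
    simpa [measureReal_def] using
      tendsto_weighted_average_simil hy yadv (hint.restrict (s := {ω | a ω = k}))
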